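/- Let r : [−1,1] → ℝ satisfy |r(t) − r(t′)| ≤ K̃·|t − t′| for all t, t′ ∈ [−1,1] and sup_{t∈[−1,1]} |r(t)| ≤ ρ, where K̃, ρ ≥ 0. Then for every x ∈ (−1,1) and every δ with 0 < δ < 1/2, the Cauchy principal value J(r,x) exists and |J(r,x)| ≤ (4/π)·ρ·ln(2/δ) + K̃·√δ. -/

import Mathlib

open Real MeasureTheory Filter Topology

lemma one_sub_sq_pos_of_mem_Ioo {t : ℝ} (ht : t ∈ Set.Ioo (-1 : ℝ) 1) : 0 < 1 - t ^ 2 := by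
  nlinarith [ht.1, ht.2]

lemma one_sub_mul_pos_of_mem {x t : ℝ} (hx : x ∈ Set.Ioo (-1 : ℝ) 1)
    (ht : t ∈ Set.Icc (-1 : ℝ) 1) : 0 < 1 - x * t := by
  have h : |x * t| ≤ |x| := by
    rw [abs_mul]
    exact mul_le_of_le_one_right (abs_nonneg x) (abs_le.2 ht)
  linarith [le_abs_self (x * t), abs_lt.2 hx]

lemma intervalIntegrable_inv_sqrt_one_sub_sq {a b : ℝ} (ha : -1 ≤ a) (hab : a ≤ b)
    (hb : b ≤ 1) : IntervalIntegrable (fun t : ℝ => 1 / √(1 - t ^ 2)) volume a b := by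
  refine intervalIntegral.intervalIntegrable_deriv_of_nonneg (g := arcsin)
    continuous_arcsin.continuousOn (fun t ht => ?_) (fun t _ => by positivity)
  rw [min_eq_left hab, max_eq_right hab] at ht
  exact hasDerivAt_arcsin (by linarith [ht.1]) (by linarith [ht.2])

lemma integral_inv_sqrt_one_sub_sq {a b : ℝ} (ha : -1 ≤ a) (hab : a ≤ b) (hb : b ≤ 1) :
    ∫ t in a..b, 1 / √(1 - t ^ 2) = arcsin b - arcsin a :=
  intervalIntegral.integral_eq_sub_of_hasDerivAt_of_le hab continuous_arcsin.continuousOn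
    (fun t ht => hasDerivAt_arcsin (by linarith [ht.1]) (by linarith [ht.2]))
    (intervalIntegrable_inv_sqrt_one_sub_sq ha hab hb)

lemma arcsin_sub_arcsin_le {a b : ℝ} (ha : -1 ≤ a) (hab : a ≤ b) (hb : b ≤ 1) :
    arcsin b - arcsin a ≤ π * √((b - a) / 2) := by
  have hD : 0 ≤ arcsin b - arcsin a := sub_nonneg.2 (monotone_arcsin hab)
  have h1 := neg_pi_div_two_le_arcsin a
  have h2 := arcsin_le_pi_div_two b
  have hπ := pi_pos
  set D := arcsin b - arcsin a with hDdef
  have hdiff : b - a = 2 * sin (D / 2) * cos ((arcsin b + arcsin a) / 2) := by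
    rw [hDdef, ← sin_sub_sin, sin_arcsin (by linarith) hb, sin_arcsin ha (by linarith)]
  have hsin : D / π ≤ sin (D / 2) := by
    have := mul_le_sin (x := D / 2) (by linarith) (by linarith)
    calc D / π = 2 / π * (D / 2) := by ring
      _ ≤ _ := this
  have hcos : sin (D / 2) ≤ cos ((arcsin b + arcsin a) / 2) := by
    rw [← cos_pi_div_two_sub, ← cos_abs ((arcsin b + arcsin a) / 2)]
    refine cos_le_cos_of_nonneg_of_le_pi (abs_nonneg _) (by linarith) ?_
    rw [abs_le]
    constructor <;> linarith
  have hpos : 0 ≤ D / π := by positivity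
  have : D / π ≤ √((b - a) / 2) := by
    apply le_sqrt_of_sq_le
    rw [hdiff]
    nlinarith
  rwa [div_le_iff₀' hπ] at this

/-- A primitive of `t ↦ √(1 - x²) / (√(1 - t²) (t - x))` away from `x`. -/
noncomputable def cauchyPrimitive (x t : ℝ) : ℝ :=
  log (t - x) - log (1 - x * t + √(1 - x ^ 2) * √(1 - t ^ 2))

lemma cauchyPrimitive_denom_pos {x t : ℝ} (hx : x ∈ Set.Ioo (-1 : ℝ) 1)
    (ht : t ∈ Set.Icc (-1 : ℝ) 1) : 0 < 1 - x * t + √(1 - x ^ 2) * √(1 - t ^ 2) := by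
  have := one_sub_mul_pos_of_mem hx ht
  positivity

lemma cauchyPrimitive_one {x : ℝ} : cauchyPrimitive x 1 = 0 := by
  simp [cauchyPrimitive]

lemma cauchyPrimitive_neg_one {x : ℝ} : cauchyPrimitive x (-1) = 0 := by
  have : (-1 - x : ℝ) = -(1 + x) := by ring
  simp [cauchyPrimitive, this, log_neg_eq_log, -neg_add_rev]

lemma neg_cauchyPrimitive_le {x t δ : ℝ} (hx : x ∈ Set.Ioo (-1 : ℝ) 1)
    (ht : t ∈ Set.Icc (-1 : ℝ) 1) (hδ : 0 < δ) (htx : δ ≤ |t - x|) :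
    -cauchyPrimitive x t ≤ log (2 / δ) := by
  have hN := cauchyPrimitive_denom_pos hx ht
  have hN2 : 1 - x * t + √(1 - x ^ 2) * √(1 - t ^ 2) ≤ 2 := by
    have h1 : 0 ≤ 1 - x ^ 2 := (one_sub_sq_pos_of_mem_Ioo hx).le
    have h2 : 0 ≤ 1 - t ^ 2 := by nlinarith [ht.1, ht.2]
    nlinarith [sq_sqrt h1, sq_sqrt h2, sq_nonneg (√(1 - x ^ 2) - √(1 - t ^ 2)),
      sq_nonneg (x + t)]
  rw [cauchyPrimitive, log_div two_ne_zero hδ.ne', ← log_abs (t - x)]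
  linarith [log_le_log hN hN2, log_le_log hδ htx]

lemma continuousOn_log_denom {x : ℝ} (hx : x ∈ Set.Ioo (-1 : ℝ) 1) :
    ContinuousOn (fun t => log (1 - x * t + √(1 - x ^ 2) * √(1 - t ^ 2)))
      (Set.Icc (-1 : ℝ) 1) :=
  ContinuousOn.log (by fun_prop) fun _ ht => (cauchyPrimitive_denom_pos hx ht).ne'

lemma hasDerivAt_cauchyPrimitive {x t : ℝ} (hx : x ∈ Set.Ioo (-1 : ℝ) 1)
    (ht : t ∈ Set.Ioo (-1 : ℝ) 1) (htx : t ≠ x) :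
    HasDerivAt (cauchyPrimitive x) (√(1 - x ^ 2) * (1 / (√(1 - t ^ 2) * (t - x)))) t := by
  have hN := cauchyPrimitive_denom_pos hx (Set.Ioo_subset_Icc_self ht)
  have hw0 := one_sub_sq_pos_of_mem_Ioo ht
  have hw := sqrt_pos.2 hw0
  have hwsq := sq_sqrt hw0.le
  have hcsq := sq_sqrt (one_sub_sq_pos_of_mem_Ioo hx).le
  have hsub : t - x ≠ 0 := sub_ne_zero.2 htx
  have d1 : HasDerivAt (fun t : ℝ => log (t - x)) (1 / (t - x)) t :=
    ((hasDerivAt_id t).sub_const x).log hsub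
  have d2 : HasDerivAt (fun t : ℝ => 1 - t ^ 2) (-(2 * t)) t := by
    simpa using (hasDerivAt_pow 2 t).const_sub 1
  have d3 : HasDerivAt (fun t : ℝ => 1 - x * t + √(1 - x ^ 2) * √(1 - t ^ 2))
      (-(x * 1) + √(1 - x ^ 2) * (-(2 * t) / (2 * √(1 - t ^ 2)))) t :=
    (((hasDerivAt_id t).const_mul x).const_sub 1).add
      ((d2.sqrt hw0.ne').const_mul (√(1 - x ^ 2)))
  have d4 := d1.sub (d3.log hN.ne')
  refine d4.congr_deriv ?_
  set w := √(1 - t ^ 2)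
  set c := √(1 - x ^ 2)
  set n := 1 - x * t + c * w with hn
  have hn0 := hN.ne'
  field_simp
  linear_combination (w - c) * hn - w * hcsq + c * hwsq

lemma intervalIntegrable_cauchyKernel {x a b : ℝ} (ha : -1 ≤ a) (hab : a ≤ b) (hb : b ≤ 1)
    (hxab : x ∉ Set.Icc a b) :
    IntervalIntegrable (fun t : ℝ => 1 / (√(1 - t ^ 2) * (t - x))) volume a b := by
  have hc : ContinuousOn (fun t : ℝ => (t - x)⁻¹) (Set.uIcc a b) := by
    rw [Set.uIcc_of_le hab]
    refine ContinuousOn.inv₀ (by fun_prop) fun t ht h => hxab ?_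
    rwa [← sub_eq_zero.1 h]
  refine ((intervalIntegrable_inv_sqrt_one_sub_sq ha hab hb).mul_continuousOn hc).congr ?_
  intro t _
  simp [mul_comm]

lemma integral_cauchyKernel {x a b : ℝ} (hx : x ∈ Set.Ioo (-1 : ℝ) 1) (ha : -1 ≤ a)
    (hab : a ≤ b) (hb : b ≤ 1) (hxab : x ∉ Set.Icc a b) :
    √(1 - x ^ 2) * ∫ t in a..b, 1 / (√(1 - t ^ 2) * (t - x)) =
      cauchyPrimitive x b - cauchyPrimitive x a := by
  rw [← intervalIntegral.integral_const_mul]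
  refine intervalIntegral.integral_eq_sub_of_hasDerivAt_of_le hab ?_ (fun t ht => ?_)
    ((intervalIntegrable_cauchyKernel ha hab hb hxab).const_mul _)
  · refine ContinuousOn.sub (ContinuousOn.log (by fun_prop) fun t ht h => hxab ?_)
      ((continuousOn_log_denom hx).mono (Set.Icc_subset_Icc ha hb))
    rwa [← sub_eq_zero.1 h]
  · refine hasDerivAt_cauchyPrimitive hx ⟨by linarith [ht.1], by linarith [ht.2]⟩ ?_
    rintro rfl
    exact hxab (Set.Ioo_subset_Icc_self ht)

/-- The principal value of `t ↦ 1 / (√(1 - t²) (t - x))` over `[-1, 1]` vanishes. -/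
lemma tendsto_integral_cauchyKernel {x : ℝ} (hx : x ∈ Set.Ioo (-1 : ℝ) 1) :
    Tendsto (fun ε : ℝ => (∫ t in (-1 : ℝ)..(x - ε), 1 / (√(1 - t ^ 2) * (t - x))) +
      ∫ t in (x + ε)..(1 : ℝ), 1 / (√(1 - t ^ 2) * (t - x))) (𝓝[>] 0) (𝓝 0) := by
  have hc := sqrt_pos.2 (one_sub_sq_pos_of_mem_Ioo hx)
  let N : ℝ → ℝ := fun t => log (1 - x * t + √(1 - x ^ 2) * √(1 - t ^ 2))
  have hN : ContinuousAt N x := (continuousOn_log_denom hx).continuousAt (Icc_mem_nhds hx.1 hx.2)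
  have hp : Tendsto (fun ε : ℝ => x + ε) (𝓝[>] 0) (𝓝 x) :=
    ((continuous_const.add continuous_id).tendsto' 0 x (by simp)).mono_left nhdsWithin_le_nhds
  have hm : Tendsto (fun ε : ℝ => x - ε) (𝓝[>] 0) (𝓝 x) :=
    ((continuous_const.sub continuous_id).tendsto' 0 x (by simp)).mono_left nhdsWithin_le_nhds
  have hlim := ((hN.tendsto.comp hp).sub (hN.tendsto.comp hm)).div_const (√(1 - x ^ 2))
  rw [sub_self, zero_div] at hlim
  refine hlim.congr' ?_
  filter_upwards [self_mem_nhdsWithin, hp.eventually (Iio_mem_nhds hx.2),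
    hm.eventually (Ioi_mem_nhds hx.1)] with ε (h0 : 0 < ε) (h1 : x + ε < 1) (h2 : -1 < x - ε)
  have e1 := integral_cauchyKernel hx le_rfl h2.le (by linarith [hx.2])
    (fun h => by linarith [h.2] : x ∉ Set.Icc (-1) (x - ε))
  have e2 := integral_cauchyKernel hx (by linarith [hx.1]) h1.le le_rfl
    (fun h => by linarith [h.1] : x ∉ Set.Icc (x + ε) 1)
  rw [cauchyPrimitive_neg_one] at e1
  rw [cauchyPrimitive_one] at e2
  have e3 : log (x - ε - x) = log (x + ε - x) := by
    rw [show x - ε - x = -(x + ε - x) by ring, log_neg_eq_log]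
  simp only [cauchyPrimitive] at e1 e2
  rw [div_eq_iff hc.ne']
  simp only [Function.comp, N]
  linear_combination -e1 - e2 - e3

section Lipschitz

variable {r : ℝ → ℝ} {K x : ℝ}

lemma abs_sub_div_cauchyKernel_le (hx : x ∈ Set.Ioo (-1 : ℝ) 1) (hK : 0 ≤ K)
    (hr : ∀ u ∈ Set.Icc (-1 : ℝ) 1, ∀ v ∈ Set.Icc (-1 : ℝ) 1, |r u - r v| ≤ K * |u - v|)
    {t : ℝ} (ht : t ∈ Set.Icc (-1 : ℝ) 1) :
    |(r t - r x) / (√(1 - t ^ 2) * (t - x))| ≤ K * (1 / √(1 - t ^ 2)) := by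
  rw [abs_div, abs_mul, abs_of_nonneg (sqrt_nonneg _), mul_comm (√_), ← div_div, mul_one_div]
  gcongr
  exact div_le_of_le_mul₀ (abs_nonneg _) hK (hr t ht x (Set.Ioo_subset_Icc_self hx))

lemma intervalIntegrable_sub_div_cauchyKernel (hx : x ∈ Set.Ioo (-1 : ℝ) 1) (hK : 0 ≤ K)
    (hr : ∀ u ∈ Set.Icc (-1 : ℝ) 1, ∀ v ∈ Set.Icc (-1 : ℝ) 1, |r u - r v| ≤ K * |u - v|) :
    IntervalIntegrable (fun t => (r t - r x) / (√(1 - t ^ 2) * (t - x))) volume (-1) 1 := by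
  have hcont : ContinuousOn r (Set.Icc (-1) 1) := by
    refine (LipschitzOnWith.of_dist_le_mul (K := ⟨K, hK⟩) fun u hu v hv => ?_).continuousOn
    exact hr u hu v hv
  refine ((intervalIntegrable_inv_sqrt_one_sub_sq le_rfl (by norm_num) le_rfl).const_mul K).mono_fun'
    ?_ ?_
  · rw [Set.uIoc_of_le (by norm_num)]
    have hnum : AEMeasurable (fun t => r t - r x) (volume.restrict (Set.Ioc (-1) 1)) :=
      ((hcont.sub continuousOn_const).mono Set.Ioc_subset_Icc_self).aemeasurable
        measurableSet_Ioc
    exact (hnum.div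
      (by fun_prop : Measurable fun t : ℝ => √(1 - t ^ 2) * (t - x)).aemeasurable).aestronglyMeasurable
  · rw [Set.uIoc_of_le (by norm_num)]
    refine (ae_restrict_mem measurableSet_Ioc).mono fun t ht => ?_
    exact abs_sub_div_cauchyKernel_le hx hK hr (Set.Ioc_subset_Icc_self ht)

lemma tendsto_principalValue_of_lipschitz (hx : x ∈ Set.Ioo (-1 : ℝ) 1) (hK : 0 ≤ K)
    (hr : ∀ u ∈ Set.Icc (-1 : ℝ) 1, ∀ v ∈ Set.Icc (-1 : ℝ) 1, |r u - r v| ≤ K * |u - v|) :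
    Tendsto (fun ε : ℝ => (∫ t in (-1 : ℝ)..(x - ε), r t / (√(1 - t ^ 2) * (t - x))) +
      ∫ t in (x + ε)..(1 : ℝ), r t / (√(1 - t ^ 2) * (t - x))) (𝓝[>] 0)
      (𝓝 (∫ t in (-1 : ℝ)..1, (r t - r x) / (√(1 - t ^ 2) * (t - x)))) := by
  set q : ℝ → ℝ := fun t => (r t - r x) / (√(1 - t ^ 2) * (t - x))
  have hq : IntervalIntegrable q volume (-1) 1 :=
    intervalIntegrable_sub_div_cauchyKernel hx hK hr
  have hsub : ∀ {a b : ℝ}, a ∈ Set.Icc (-1 : ℝ) 1 → b ∈ Set.Icc (-1 : ℝ) 1 →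
      IntervalIntegrable q volume a b := fun ha hb => by
    refine hq.mono_set (Set.uIcc_subset_uIcc ?_ ?_) <;>
      rwa [Set.uIcc_of_le (by norm_num)]
  have hprim : ContinuousAt (fun y => ∫ t in (-1 : ℝ)..y, q t) x := by
    refine (intervalIntegral.continuousOn_primitive_interval' hq (by simp)).continuousAt ?_
    rw [Set.uIcc_of_le (by norm_num)]
    exact Icc_mem_nhds hx.1 hx.2
  have hp : Tendsto (fun ε : ℝ => x + ε) (𝓝[>] 0) (𝓝 x) :=
    ((continuous_const.add continuous_id).tendsto' 0 x (by simp)).mono_left nhdsWithin_le_nhds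
  have hm : Tendsto (fun ε : ℝ => x - ε) (𝓝[>] 0) (𝓝 x) :=
    ((continuous_const.sub continuous_id).tendsto' 0 x (by simp)).mono_left nhdsWithin_le_nhds
  have hlim := ((hprim.tendsto.comp hm).add
    ((tendsto_const_nhds (x := ∫ t in (-1 : ℝ)..1, q t)).sub (hprim.tendsto.comp hp))).add
    ((tendsto_integral_cauchyKernel hx).const_mul (r x))
  rw [mul_zero, add_zero, add_sub_cancel] at hlim
  refine hlim.congr' ?_
  filter_upwards [self_mem_nhdsWithin, hp.eventually (Iio_mem_nhds hx.2),
    hm.eventually (Ioi_mem_nhds hx.1)] with ε (h0 : 0 < ε) (h1 : x + ε < 1) (h2 : -1 < x - ε)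
  have hneg : (-1 : ℝ) ∈ Set.Icc (-1 : ℝ) 1 := by simp
  have hmI : x - ε ∈ Set.Icc (-1 : ℝ) 1 := ⟨h2.le, by linarith⟩
  have hpI : x + ε ∈ Set.Icc (-1 : ℝ) 1 := ⟨by linarith, h1.le⟩
  have hsplit : ∀ t, r t / (√(1 - t ^ 2) * (t - x)) =
      q t + r x * (1 / (√(1 - t ^ 2) * (t - x))) := fun t => by
    simp only [q]
    ring
  simp only [hsplit, Function.comp]
  rw [intervalIntegral.integral_add (hsub (by simp) hmI)
      ((intervalIntegrable_cauchyKernel le_rfl h2.le hmI.2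
        (fun h => by linarith [h.2])).const_mul _),
    intervalIntegral.integral_add (hsub hpI (by simp))
      ((intervalIntegrable_cauchyKernel hpI.1 h1.le le_rfl
        (fun h => by linarith [h.1])).const_mul _),
    intervalIntegral.integral_const_mul, intervalIntegral.integral_const_mul,
    ← intervalIntegral.integral_interval_sub_left (hsub hneg (by simp)) (hsub hneg hpI)]
  ring

end Lipschitz

section Bounded

variable {r : ℝ → ℝ} {ρ x : ℝ}

lemma abs_sub_div_le_two_mul_abs (hx : x ∈ Set.Icc (-1 : ℝ) 1)
    (hrb : ∀ u ∈ Set.Icc (-1 : ℝ) 1, |r u| ≤ ρ) {t : ℝ} (ht : t ∈ Set.Icc (-1 : ℝ) 1) (d : ℝ) :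
    |(r t - r x) / d| ≤ 2 * ρ * |1 / d| := by
  rw [abs_div, abs_div, abs_one, mul_one_div]
  gcongr
  linarith [abs_sub (r t) (r x), hrb t ht, hrb x hx]

lemma abs_integral_sub_div_le_of_lt {a : ℝ} (hx : x ∈ Set.Ioo (-1 : ℝ) 1)
    (hrb : ∀ u ∈ Set.Icc (-1 : ℝ) 1, |r u| ≤ ρ) (ha : -1 ≤ a) (hax : a < x) :
    √(1 - x ^ 2) * |∫ t in (-1 : ℝ)..a, (r t - r x) / (√(1 - t ^ 2) * (t - x))| ≤
      2 * ρ * -cauchyPrimitive x a := by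
  have hk := intervalIntegrable_cauchyKernel le_rfl ha (hax.trans hx.2).le
    (fun h => by linarith [h.2] : x ∉ Set.Icc (-1) a)
  have hI := integral_cauchyKernel hx le_rfl ha (hax.trans hx.2).le
    (fun h => by linarith [h.2] : x ∉ Set.Icc (-1) a)
  have hle := intervalIntegral.norm_integral_le_of_norm_le ha (μ := volume)
    (f := fun t => (r t - r x) / (√(1 - t ^ 2) * (t - x)))
    (g := fun t => -(2 * ρ) * (1 / (√(1 - t ^ 2) * (t - x))))
    (ae_of_all _ fun t ht => by
      have h := abs_sub_div_le_two_mul_abs (Set.Ioo_subset_Icc_self hx) hrb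
        (⟨ht.1.le, by linarith [ht.2, hx.2]⟩ : t ∈ Set.Icc (-1 : ℝ) 1) (√(1 - t ^ 2) * (t - x))
      rw [abs_of_nonpos (one_div_nonpos.2
        (mul_nonpos_of_nonneg_of_nonpos (sqrt_nonneg _) (by linarith [ht.2])))] at h
      rw [norm_eq_abs]
      linarith) (hk.const_mul _)
  rw [intervalIntegral.integral_const_mul, norm_eq_abs] at hle
  rw [cauchyPrimitive_neg_one] at hI
  have := mul_le_mul_of_nonneg_left hle (sqrt_nonneg (1 - x ^ 2))
  linear_combination this - 2 * ρ * hI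

lemma abs_integral_sub_div_le_of_gt {b : ℝ} (hx : x ∈ Set.Ioo (-1 : ℝ) 1)
    (hrb : ∀ u ∈ Set.Icc (-1 : ℝ) 1, |r u| ≤ ρ) (hxb : x < b) (hb : b ≤ 1) :
    √(1 - x ^ 2) * |∫ t in b..(1 : ℝ), (r t - r x) / (√(1 - t ^ 2) * (t - x))| ≤
      2 * ρ * -cauchyPrimitive x b := by
  have hk := intervalIntegrable_cauchyKernel (hx.1.trans hxb).le hb le_rfl
    (fun h => by linarith [h.1] : x ∉ Set.Icc b 1)
  have hI := integral_cauchyKernel hx (hx.1.trans hxb).le hb le_rfl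
    (fun h => by linarith [h.1] : x ∉ Set.Icc b 1)
  have hle := intervalIntegral.norm_integral_le_of_norm_le hb (μ := volume)
    (f := fun t => (r t - r x) / (√(1 - t ^ 2) * (t - x)))
    (g := fun t => 2 * ρ * (1 / (√(1 - t ^ 2) * (t - x))))
    (ae_of_all _ fun t ht => by
      have h := abs_sub_div_le_two_mul_abs (Set.Ioo_subset_Icc_self hx) hrb
        (⟨by linarith [ht.1, hx.1], ht.2⟩ : t ∈ Set.Icc (-1 : ℝ) 1) (√(1 - t ^ 2) * (t - x))
      rw [abs_of_nonneg (one_div_nonneg.2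
        (mul_nonneg (sqrt_nonneg _) (by linarith [ht.1])))] at h
      rwa [norm_eq_abs]) (hk.const_mul _)
  rw [intervalIntegral.integral_const_mul, norm_eq_abs] at hle
  rw [cauchyPrimitive_one] at hI
  have := mul_le_mul_of_nonneg_left hle (sqrt_nonneg (1 - x ^ 2))
  linear_combination this + 2 * ρ * hI

end Bounded

theorem pv_bound_of_lipschitz
    (r : ℝ → ℝ) (K ρ : ℝ) (hK : 0 ≤ K) (hρ : 0 ≤ ρ)
    (hr : ∀ u ∈ Set.Icc (-1 : ℝ) 1, ∀ v ∈ Set.Icc (-1 : ℝ) 1, |r u - r v| ≤ K * |u - v|)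
    (hrb : ∀ u ∈ Set.Icc (-1 : ℝ) 1, |r u| ≤ ρ)
    (x : ℝ) (hx : x ∈ Set.Ioo (-1 : ℝ) 1) (δ : ℝ) (hδ : 0 < δ) (hδ2 : δ < 1 / 2) :
    ∃ I : ℝ,
      Tendsto (fun ε : ℝ =>
          (∫ u in (-1 : ℝ)..(x - ε), r u / (Real.sqrt (1 - u ^ 2) * (u - x))) +
          ∫ u in (x + ε)..(1 : ℝ), r u / (Real.sqrt (1 - u ^ 2) * (u - x)))
        (𝓝[>] (0 : ℝ)) (𝓝 I) ∧
      |Real.sqrt (1 - x ^ 2) / π * I| ≤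
        (4 / π) * ρ * Real.log (2 / δ) + K * Real.sqrt δ := by
  refine ⟨_, tendsto_principalValue_of_lipschitz hx hK hr, ?_⟩
  have hq := intervalIntegrable_sub_div_cauchyKernel hx hK hr
  have hL : 0 ≤ log (2 / δ) := log_nonneg (by rw [le_div_iff₀ hδ]; linarith)
  have hc0 := sqrt_nonneg (1 - x ^ 2)
  have hc1 : √(1 - x ^ 2) ≤ 1 := sqrt_le_one.2 (by nlinarith [sq_nonneg x])
  obtain ⟨a, ha, hax, had, haL⟩ : ∃ a, -1 ≤ a ∧ a < x ∧ x - δ ≤ a ∧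
      -cauchyPrimitive x a ≤ log (2 / δ) := by
    rcases le_total (x - δ) (-1) with h | h
    · exact ⟨-1, le_rfl, hx.1, h, by simpa [cauchyPrimitive_neg_one] using hL⟩
    · refine ⟨x - δ, h, by linarith, le_rfl,
        neg_cauchyPrimitive_le hx ⟨h, by linarith [hx.2]⟩ hδ ?_⟩
      rw [sub_sub_cancel_left, abs_neg, abs_of_pos hδ]
  obtain ⟨b, hb, hxb, hbd, hbL⟩ : ∃ b, b ≤ 1 ∧ x < b ∧ b ≤ x + δ ∧
      -cauchyPrimitive x b ≤ log (2 / δ) := by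
    rcases le_total 1 (x + δ) with h | h
    · exact ⟨1, le_rfl, hx.2, h, by simpa [cauchyPrimitive_one] using hL⟩
    · refine ⟨x + δ, h, by linarith, le_rfl,
        neg_cauchyPrimitive_le hx ⟨by linarith [hx.1], h⟩ hδ ?_⟩
      rw [add_sub_cancel_left, abs_of_pos hδ]
  have hab : a ≤ b := (hax.trans hxb).le
  have hleft := abs_integral_sub_div_le_of_lt hx hrb ha hax
  have hright := abs_integral_sub_div_le_of_gt hx hrb hxb hb
  have hmid : |∫ t in a..b, (r t - r x) / (√(1 - t ^ 2) * (t - x))| ≤ K * (π * √δ) := by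
    have hle := intervalIntegral.norm_integral_le_of_norm_le hab (μ := volume)
      (f := fun t => (r t - r x) / (√(1 - t ^ 2) * (t - x)))
      (g := fun t => K * (1 / √(1 - t ^ 2)))
      (ae_of_all _ fun t ht =>
        abs_sub_div_cauchyKernel_le hx hK hr ⟨ha.trans ht.1.le, ht.2.trans hb⟩)
      ((intervalIntegrable_inv_sqrt_one_sub_sq ha hab hb).const_mul K)
    rw [intervalIntegral.integral_const_mul, integral_inv_sqrt_one_sub_sq ha hab hb] at hle
    refine hle.trans (mul_le_mul_of_nonneg_left ((arcsin_sub_arcsin_le ha hab hb).trans ?_) hK)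
    gcongr
    linarith
  set q : ℝ → ℝ := fun t => (r t - r x) / (√(1 - t ^ 2) * (t - x))
  have hsub : ∀ {u v : ℝ}, u ∈ Set.Icc (-1 : ℝ) 1 → v ∈ Set.Icc (-1 : ℝ) 1 →
      IntervalIntegrable q volume u v := fun hu hv => by
    refine hq.mono_set (Set.uIcc_subset_uIcc ?_ ?_) <;>
      rwa [Set.uIcc_of_le (by norm_num)]
  have haI : a ∈ Set.Icc (-1 : ℝ) 1 := ⟨ha, hab.trans hb⟩
  have hbI : b ∈ Set.Icc (-1 : ℝ) 1 := ⟨ha.trans hab, hb⟩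
  rw [← intervalIntegral.integral_add_adjacent_intervals (hsub (by simp) hbI)
      (hsub hbI (by simp)),
    ← intervalIntegral.integral_add_adjacent_intervals (hsub (by simp) haI) (hsub haI hbI)]
  have htri := abs_add_three (∫ t in (-1 : ℝ)..a, q t) (∫ t in a..b, q t) (∫ t in b..1, q t)
  have hmid' := mul_le_mul hc1 hmid (abs_nonneg _) zero_le_one
  have haL' := mul_le_mul_of_nonneg_left haL (by positivity : 0 ≤ 2 * ρ)
  have hbL' := mul_le_mul_of_nonneg_left hbL (by positivity : 0 ≤ 2 * ρ)
  have htri' := mul_le_mul_of_nonneg_left htri hc0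
  rw [abs_mul, abs_of_nonneg (by positivity), div_mul_eq_mul_div, div_le_iff₀ pi_pos]
  calc _ ≤ 4 * ρ * log (2 / δ) + K * (π * √δ) := by linarith
    _ = _ := by field_simp
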